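/- The extended-model function V(·,·;σ₁,σ₂) satisfies the boundary conditions: for each fixed y > 0, V(x,y;σ₁,σ₂) → 0 as x → 0⁺ and V(x,y;σ₁,σ₂) → 1 − exp(−2(μ̄+δσ₁)y/σ₂²) as x → ∞; and for each fixed x > 0, V(x,y;σ₁,σ₂) → 0 as y → 0⁺ and V(x,y;σ₁,σ₂) → 1 − exp(−2(μ̄+δσ₂)x/σ₁²) as y → ∞. -/

import Mathlib

open MeasureTheory Set Filter

noncomputable def Phi (z : ℝ) : ℝ :=
  (Real.sqrt (2 * Real.pi))⁻¹ * ∫ u in Set.Iio z, Real.exp (-(u ^ 2) / 2)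

/-- The explicit formula for the value function of the extended model in the region
`y > (σ₂/σ₁) x`, with `N`, `A`, `B`, `C` as in the paper. -/
noncomputable def VformE (μ δ σ₁ σ₂ x y : ℝ) : ℝ :=
  Phi ((δ * σ₂ * x + (μ + δ * σ₂) * y)
      / Real.sqrt (σ₂ * (σ₁ * y - σ₂ * x) * (μ + δ * (σ₁ + σ₂))))
    - Real.exp (-(2 * μ * (x + y)) / (σ₁ + σ₂) ^ 2)
      * Phi (((2 * μ + δ * (σ₁ + σ₂)) * σ₂ * x + ((μ + δ * σ₂) * (σ₁ + σ₂) - 2 * μ * σ₁) * y)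
        / ((σ₁ + σ₂) * Real.sqrt (σ₂ * (σ₁ * y - σ₂ * x) * (μ + δ * (σ₁ + σ₂)))))
    - Real.exp (-(2 * (μ + δ * σ₂) * x) / σ₁ ^ 2)
      * Phi (((μ + δ * σ₂) * y - (2 * μ + δ * (σ₁ + σ₂) + δ * σ₂) * (σ₂ / σ₁) * x)
        / Real.sqrt (σ₂ * (σ₁ * y - σ₂ * x) * (μ + δ * (σ₁ + σ₂))))
    + Real.exp (-(2 * μ * y) / (σ₁ + σ₂) ^ 2
          - 2 * σ₂ * x / σ₁ ^ 2 * (μ * σ₂ / (σ₁ + σ₂) ^ 2 + δ))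
      * Phi ((((μ + δ * σ₂) * (σ₁ + σ₂) - 2 * μ * σ₁) * y
            - (δ * σ₁ ^ 2 + 3 * δ * σ₁ * σ₂ + 2 * (μ + δ * σ₂) * σ₂) * (σ₂ / σ₁) * x)
        / ((σ₁ + σ₂) * Real.sqrt (σ₂ * (σ₁ * y - σ₂ * x) * (μ + δ * (σ₁ + σ₂)))))

open Classical in
/-- The explicit value function of the extended model. -/
noncomputable def Vext (μ δ σ₁ σ₂ x y : ℝ) : ℝ :=
  if σ₂ / σ₁ * x < y then VformE μ δ σ₁ σ₂ x y
  else if y < σ₂ / σ₁ * x then VformE μ δ σ₂ σ₁ y x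
  else 1 - Real.exp (-(2 * μ * x) / (σ₁ * (σ₁ + σ₂)))

/-- Partial derivative of `Vext` in `x`. -/
noncomputable def VxE (μ δ σ₁ σ₂ x y : ℝ) : ℝ := deriv (fun x' => Vext μ δ σ₁ σ₂ x' y) x

/-- Partial derivative of `Vext` in `y`. -/
noncomputable def VyE (μ δ σ₁ σ₂ x y : ℝ) : ℝ := deriv (fun y' => Vext μ δ σ₁ σ₂ x y') y

/-- Second partial derivative of `Vext` in `x`. -/
noncomputable def VxxE (μ δ σ₁ σ₂ x y : ℝ) : ℝ := deriv (fun x' => VxE μ δ σ₁ σ₂ x' y) x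

/-- Second partial derivative of `Vext` in `y`. -/
noncomputable def VyyE (μ δ σ₁ σ₂ x y : ℝ) : ℝ := deriv (fun y' => VyE μ δ σ₁ σ₂ x y') y

/-- Mixed second partial derivative of `Vext`. -/
noncomputable def VxyE (μ δ σ₁ σ₂ x y : ℝ) : ℝ := deriv (fun y' => VxE μ δ σ₁ σ₂ x y') y

lemma gauss_int : Integrable (fun u : ℝ => Real.exp (-(u ^ 2) / 2)) := by
  have h := integrable_exp_neg_mul_sq (b := 1 / 2) (by norm_num)
  refine h.congr (Filter.Eventually.of_forall fun u => ?_)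
  simp only
  congr 1
  ring

lemma gauss_total : ∫ u : ℝ, Real.exp (-(u ^ 2) / 2) = Real.sqrt (2 * Real.pi) := by
  have h := integral_gaussian (1 / 2)
  have e : Real.pi / (1 / 2) = 2 * Real.pi := by ring
  rw [e] at h
  rw [← h]
  congr 1
  funext u
  congr 1
  ring

lemma Phi_continuous : Continuous Phi := by
  have h : Phi = fun z => (Real.sqrt (2 * Real.pi))⁻¹ *
      ((∫ u in Set.Iic (0:ℝ), Real.exp (-(u ^ 2) / 2)) +
        ∫ u in (0:ℝ)..z, Real.exp (-(u ^ 2) / 2)) := by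
    funext z
    have := intervalIntegral.integral_Iic_sub_Iic (μ := volume) (a := (0:ℝ)) (b := z)
      (f := fun u : ℝ => Real.exp (-(u ^ 2) / 2)) gauss_int.integrableOn gauss_int.integrableOn
    rw [← this, Phi, ← integral_Iic_eq_integral_Iio]
    ring
  rw [h]
  refine continuous_const.mul (continuous_const.add ?_)
  exact intervalIntegral.continuous_primitive (fun a b => gauss_int.intervalIntegrable) 0

lemma Phi_tendsto : Tendsto Phi atTop (nhds 1) := by
  have h := (aecover_Iio (μ := volume) (l := atTop) (b := fun z : ℝ => z)
    tendsto_id).integral_tendsto_of_countably_generated gauss_int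
  rw [gauss_total] at h
  have h2 := h.const_mul (Real.sqrt (2 * Real.pi))⁻¹
  rw [inv_mul_cancel₀ (by positivity)] at h2
  exact h2

lemma Phi_nonneg (z : ℝ) : 0 ≤ Phi z := by
  unfold Phi
  have : 0 ≤ ∫ u in Set.Iio z, Real.exp (-(u ^ 2) / 2) :=
    integral_nonneg fun u => (Real.exp_pos _).le
  positivity

lemma Phi_le_one (z : ℝ) : Phi z ≤ 1 := by
  unfold Phi
  have : ∫ u in Set.Iio z, Real.exp (-(u ^ 2) / 2) ≤ Real.sqrt (2 * Real.pi) := by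
    rw [← gauss_total]
    exact setIntegral_le_integral gauss_int (Filter.Eventually.of_forall fun u => (Real.exp_pos _).le)
  calc _ ≤ (Real.sqrt (2 * Real.pi))⁻¹ * Real.sqrt (2 * Real.pi) := by gcongr
    _ = 1 := inv_mul_cancel₀ (by positivity)

lemma arg_tendsto (a b c d : ℝ) (hb : 0 < b) (hc : 0 < c) :
    Tendsto (fun y : ℝ => (a + b * y) / Real.sqrt (c * y - d)) atTop atTop := by
  have h1 : Tendsto (fun y : ℝ => c * y - d) atTop atTop :=
    tendsto_atTop_add_const_right _ (-d) (tendsto_id.const_mul_atTop hc)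
  have hu : Tendsto (fun y : ℝ => Real.sqrt (c * y - d)) atTop atTop :=
    Real.tendsto_sqrt_atTop.comp h1
  have h2 : Tendsto (fun y : ℝ => (b / c) * Real.sqrt (c * y - d)
      + (a + b * d / c) / Real.sqrt (c * y - d)) atTop atTop :=
    Tendsto.atTop_add (hu.const_mul_atTop (by positivity)) (tendsto_const_nhds.div_atTop hu)
  refine h2.congr' ?_
  filter_upwards [h1.eventually_gt_atTop 0] with y hy
  have hs : 0 < Real.sqrt (c * y - d) := Real.sqrt_pos.2 hy
  have hq : Real.sqrt (c * y - d) ^ 2 = c * y - d := Real.sq_sqrt hy.le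
  field_simp
  rw [hq]
  ring

lemma exp_Phi_tendsto (f g : ℝ → ℝ) (hf : Tendsto f atTop atBot) :
    Tendsto (fun y => Real.exp (f y) * Phi (g y)) atTop (nhds 0) := by
  refine squeeze_zero (fun y => mul_nonneg (Real.exp_pos _).le (Phi_nonneg _))
    (fun y => mul_le_of_le_one_right (Real.exp_pos _).le (Phi_le_one _))
    (Real.tendsto_exp_atBot.comp hf)

lemma lin_atBot (a b : ℝ) (ha : 0 < a) : Tendsto (fun y : ℝ => -(a * y) + b) atTop atBot :=
  tendsto_atBot_add_const_right _ _
    (tendsto_neg_atTop_atBot.comp (tendsto_id.const_mul_atTop ha))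

lemma params (μ δ σ₁ σ₂ : ℝ) (hμ : 0 < μ) (hσ₁ : 0 < σ₁) (hσ₂ : 0 < σ₂)
    (hδ : -(μ / (σ₁ + σ₂)) < δ) : 0 < μ + δ * (σ₁ + σ₂) ∧ 0 < μ + δ * σ₂ := by
  have h1 : 0 < μ + δ * (σ₁ + σ₂) := by
    have hs : 0 < σ₁ + σ₂ := by positivity
    have := mul_lt_mul_of_pos_right hδ hs
    rw [neg_mul, div_mul_cancel₀ _ hs.ne'] at this
    linarith
  refine ⟨h1, ?_⟩
  rcases le_total 0 δ with h | h
  · positivity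
  · nlinarith

lemma form_top (μ δ σ₁ σ₂ : ℝ) (hμ : 0 < μ) (hσ₁ : 0 < σ₁) (hσ₂ : 0 < σ₂)
    (hδ : -(μ / (σ₁ + σ₂)) < δ) (x : ℝ) :
    Tendsto (fun y => VformE μ δ σ₁ σ₂ x y) atTop
      (nhds (1 - Real.exp (-(2 * (μ + δ * σ₂) * x) / σ₁ ^ 2))) := by
  obtain ⟨hD, hE⟩ := params μ δ σ₁ σ₂ hμ hσ₁ hσ₂ hδ
  have key : ∀ a : ℝ, Tendsto (fun y : ℝ => Phi ((a + (μ + δ * σ₂) * y)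
      / Real.sqrt (σ₂ * (σ₁ * y - σ₂ * x) * (μ + δ * (σ₁ + σ₂))))) atTop (nhds 1) := by
    intro a
    refine Phi_tendsto.comp ((arg_tendsto a (μ + δ * σ₂) (σ₂ * σ₁ * (μ + δ * (σ₁ + σ₂)))
      (σ₂ * σ₂ * x * (μ + δ * (σ₁ + σ₂))) hE (by positivity)).congr fun y => ?_)
    congr 2
    ring
  have t1 := key (δ * σ₂ * x)
  have t3 := (key (-((2 * μ + δ * (σ₁ + σ₂) + δ * σ₂) * (σ₂ / σ₁) * x))).const_mul
    (Real.exp (-(2 * (μ + δ * σ₂) * x) / σ₁ ^ 2))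
  have hp : 0 < 2 * μ / (σ₁ + σ₂) ^ 2 := by positivity
  have t2 := exp_Phi_tendsto (fun y => -(2 * μ * (x + y)) / (σ₁ + σ₂) ^ 2)
    (fun y => ((2 * μ + δ * (σ₁ + σ₂)) * σ₂ * x + ((μ + δ * σ₂) * (σ₁ + σ₂) - 2 * μ * σ₁) * y)
        / ((σ₁ + σ₂) * Real.sqrt (σ₂ * (σ₁ * y - σ₂ * x) * (μ + δ * (σ₁ + σ₂)))))
    ((lin_atBot _ (-(2 * μ / (σ₁ + σ₂) ^ 2 * x)) hp).congr fun y => by ring)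
  have t4 := exp_Phi_tendsto (fun y => -(2 * μ * y) / (σ₁ + σ₂) ^ 2
          - 2 * σ₂ * x / σ₁ ^ 2 * (μ * σ₂ / (σ₁ + σ₂) ^ 2 + δ))
    (fun y => (((μ + δ * σ₂) * (σ₁ + σ₂) - 2 * μ * σ₁) * y
            - (δ * σ₁ ^ 2 + 3 * δ * σ₁ * σ₂ + 2 * (μ + δ * σ₂) * σ₂) * (σ₂ / σ₁) * x)
        / ((σ₁ + σ₂) * Real.sqrt (σ₂ * (σ₁ * y - σ₂ * x) * (μ + δ * (σ₁ + σ₂)))))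
    ((lin_atBot _ (-(2 * σ₂ * x / σ₁ ^ 2 * (μ * σ₂ / (σ₁ + σ₂) ^ 2 + δ))) hp).congr
      fun y => by ring)
  have t := ((t1.sub t2).sub t3).add t4
  rw [sub_zero, mul_one, add_zero] at t
  refine t.congr fun y => ?_
  unfold VformE
  rw [neg_add_eq_sub]

lemma form_zero (μ δ σ₁ σ₂ : ℝ) (hμ : 0 < μ) (hσ₁ : 0 < σ₁) (hσ₂ : 0 < σ₂)
    (hδ : -(μ / (σ₁ + σ₂)) < δ) (y : ℝ) (hy : 0 < y) :
    Tendsto (fun x => VformE μ δ σ₁ σ₂ x y) (nhdsWithin 0 (Set.Ioi 0)) (nhds 0) := by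
  obtain ⟨hD, hE⟩ := params μ δ σ₁ σ₂ hμ hσ₁ hσ₂ hδ
  have h0 : VformE μ δ σ₁ σ₂ 0 y = 0 := by
    unfold VformE
    simp
  have hN : Real.sqrt (σ₂ * (σ₁ * y - σ₂ * 0) * (μ + δ * (σ₁ + σ₂))) ≠ 0 := by
    rw [mul_zero, sub_zero]
    positivity
  have hs : (σ₁ + σ₂) * Real.sqrt (σ₂ * (σ₁ * y - σ₂ * 0) * (μ + δ * (σ₁ + σ₂))) ≠ 0 :=
    mul_ne_zero (by positivity) hN
  have hP : ∀ {g : ℝ → ℝ}, ContinuousAt g 0 → ContinuousAt (fun x => Phi (g x)) 0 :=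
    fun hg => Phi_continuous.continuousAt.comp hg
  have hc : ContinuousAt (fun x => VformE μ δ σ₁ σ₂ x y) 0 := by
    unfold VformE
    refine ((ContinuousAt.sub (ContinuousAt.sub (hP ?_) (ContinuousAt.mul ?_ (hP ?_)))
      (ContinuousAt.mul ?_ (hP ?_)))).add (ContinuousAt.mul ?_ (hP ?_))
    · exact ContinuousAt.div (by fun_prop) (by fun_prop) hN
    · fun_prop
    · exact ContinuousAt.div (by fun_prop) (by fun_prop) hs
    · fun_prop
    · exact ContinuousAt.div (by fun_prop) (by fun_prop) hN
    · fun_prop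
    · exact ContinuousAt.div (by fun_prop) (by fun_prop) hs
  have := hc.tendsto
  rw [h0] at this
  exact this.mono_left nhdsWithin_le_nhds

lemma Vext_up (μ δ σ₁ σ₂ x y : ℝ) (h : σ₂ / σ₁ * x < y) :
    Vext μ δ σ₁ σ₂ x y = VformE μ δ σ₁ σ₂ x y := by
  unfold Vext
  rw [if_pos h]

lemma Vext_down (μ δ σ₁ σ₂ x y : ℝ) (h : y < σ₂ / σ₁ * x) :
    Vext μ δ σ₁ σ₂ x y = VformE μ δ σ₂ σ₁ y x := by
  unfold Vext
  rw [if_neg h.not_gt, if_pos h]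

theorem stmt18 (μ δ σ₁ σ₂ : ℝ) (hμ : 0 < μ) (hσ₁ : 0 < σ₁) (hσ₂ : 0 < σ₂)
    (hδ : -(μ / (σ₁ + σ₂)) < δ) :
    (∀ y : ℝ, 0 < y →
        Tendsto (fun x => Vext μ δ σ₁ σ₂ x y) (nhdsWithin 0 (Set.Ioi 0)) (nhds 0)
        ∧ Tendsto (fun x => Vext μ δ σ₁ σ₂ x y) atTop
            (nhds (1 - Real.exp (-(2 * (μ + δ * σ₁) * y) / σ₂ ^ 2))))
    ∧ (∀ x : ℝ, 0 < x →
        Tendsto (fun y => Vext μ δ σ₁ σ₂ x y) (nhdsWithin 0 (Set.Ioi 0)) (nhds 0)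
        ∧ Tendsto (fun y => Vext μ δ σ₁ σ₂ x y) atTop
            (nhds (1 - Real.exp (-(2 * (μ + δ * σ₂) * x) / σ₁ ^ 2)))) := by
  have hδ' : -(μ / (σ₂ + σ₁)) < δ := by rwa [add_comm]
  have hr : 0 < σ₂ / σ₁ := by positivity
  refine ⟨fun y hy => ⟨?_, ?_⟩, fun x hx => ⟨?_, ?_⟩⟩
  · refine (form_zero μ δ σ₁ σ₂ hμ hσ₁ hσ₂ hδ y hy).congr' ?_
    have hc : Tendsto (fun x : ℝ => σ₂ / σ₁ * x) (nhdsWithin 0 (Set.Ioi 0)) (nhds (σ₂ / σ₁ * 0)) :=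
      (Continuous.tendsto (by fun_prop) 0).mono_left nhdsWithin_le_nhds
    rw [mul_zero] at hc
    filter_upwards [hc.eventually_lt_const hy] with x hx
    exact (Vext_up _ _ _ _ _ _ hx).symm
  · refine (form_top μ δ σ₂ σ₁ hμ hσ₂ hσ₁ hδ' y).congr' ?_
    filter_upwards [(tendsto_id.const_mul_atTop hr).eventually_gt_atTop y] with x hx
    exact (Vext_down _ _ _ _ _ _ hx).symm
  · refine (form_zero μ δ σ₂ σ₁ hμ hσ₂ hσ₁ hδ' x hx).congr' ?_
    have hp : 0 < σ₂ / σ₁ * x := by positivity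
    filter_upwards [nhdsWithin_le_nhds (eventually_lt_nhds hp)] with y hy
    exact (Vext_down _ _ _ _ _ _ hy).symm
  · refine (form_top μ δ σ₁ σ₂ hμ hσ₁ hσ₂ hδ x).congr' ?_
    filter_upwards [eventually_gt_atTop (σ₂ / σ₁ * x)] with y hy
    exact (Vext_up _ _ _ _ _ _ hy).symm
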